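/- arXiv:2002.06307 — 3 statements merged into one kernel-verified Lean document; each statement's English description precedes it below -/
import Mathlib

section
/- For any two parameter values θ₀ and θ₁, the Kullback–Leibler divergence between the marginal distributions of the GAN-generated data under θ₀ and θ₁ is at most the Kullback–Leibler divergence between the distributions of the training data: D_KL( P_D(·|θ₀) ‖ P_D(·|θ₁) ) ≤ D_KL( pT(·|θ₀) ‖ pT(·|θ₁) ), where P_D(d|θ) = Σ_{t,g} P(t,g,d|θ) and we assume pT(t|θ₁) > 0 whenever pT(t|θ₀) > 0. In other words, two hypotheses are no more distinguishable using GAN-generated data than using only the training data. -/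
/-- Kullback–Leibler divergence between two pmfs on a finite type,
`D_KL(p‖q) = ∑_{x : p x > 0} p x * log (p x / q x)`. -/
noncomputable def klDiv {X : Type*} [Fintype X] (p q : X → ℝ) : ℝ :=
  ∑ x, if 0 < p x then p x * Real.log (p x / q x) else 0

theorem klDiv_eq_sum {X : Type*} [Fintype X] {p : X → ℝ} (hp : ∀ x, 0 ≤ p x) (q : X → ℝ) :
    klDiv p q = ∑ x, p x * Real.log (p x / q x) := by
  refine Finset.sum_congr rfl fun x _ => ?_
  split_ifs with h
  · rfl
  · rw [le_antisymm (not_lt.mp h) (hp x), zero_mul]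

/-- The log-sum inequality. -/
theorem sum_mul_log_div_sum_le {ι : Type*} (s : Finset ι) {a b : ι → ℝ}
    (ha : ∀ i ∈ s, 0 ≤ a i) (hb : ∀ i ∈ s, 0 ≤ b i) (hab : ∀ i ∈ s, 0 < a i → 0 < b i) :
    (∑ i ∈ s, a i) * Real.log ((∑ i ∈ s, a i) / ∑ i ∈ s, b i)
      ≤ ∑ i ∈ s, a i * Real.log (a i / b i) := by
  set A := ∑ i ∈ s, a i with hA
  set B := ∑ i ∈ s, b i with hB
  rcases (Finset.sum_nonneg ha).eq_or_lt with h0 | hApos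
  · have hz := (Finset.sum_eq_zero_iff_of_nonneg ha).mp h0.symm
    rw [hA, ← h0, zero_mul]
    exact (Finset.sum_eq_zero fun i hi => by rw [hz i hi, zero_mul]).ge
  obtain ⟨j, hj, hja⟩ := Finset.exists_lt_of_sum_lt
    (show ∑ i ∈ s, (0 : ℝ) < ∑ i ∈ s, a i by simpa using hApos)
  have hBpos : 0 < B := Finset.sum_pos' hb ⟨j, hj, hab j hj hja⟩
  have key : ∀ i ∈ s, a i * Real.log (A / B) + (a i - b i * (A / B))
      ≤ a i * Real.log (a i / b i) := by
    intro i hi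
    rcases (ha i hi).eq_or_lt with h | h
    · have : 0 ≤ b i * (A / B) := mul_nonneg (hb i hi) (div_pos hApos hBpos).le
      simpa [← h] using this
    · have hbi := hab i hi h
      have hlog := Real.one_sub_inv_le_log_of_pos (div_pos (div_pos h hbi) (div_pos hApos hBpos))
      rw [Real.log_div (div_pos h hbi).ne' (div_pos hApos hBpos).ne'] at hlog
      have hmul := mul_le_mul_of_nonneg_left hlog h.le
      have hinv : a i * (1 - (a i / b i / (A / B))⁻¹) = a i - b i * (A / B) := by
        field_simp
      linarith
  have hsum := Finset.sum_le_sum key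
  rw [Finset.sum_add_distrib, Finset.sum_sub_distrib, ← Finset.sum_mul, ← Finset.sum_mul,
    ← hA, ← hB, mul_div_cancel₀ A hBpos.ne', sub_self, add_zero] at hsum
  exact hsum

/-- The data processing inequality for a Markov kernel `K` between finite types. -/
theorem klDiv_sum_mul_le {X Y : Type*} [Fintype X] [Fintype Y] {p q : X → ℝ} {K : X → Y → ℝ}
    (hp : ∀ x, 0 ≤ p x) (hq : ∀ x, 0 ≤ q x) (hpq : ∀ x, 0 < p x → 0 < q x)
    (hK : ∀ x y, 0 ≤ K x y) (hK1 : ∀ x, ∑ y, K x y = 1) :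
    klDiv (fun y => ∑ x, p x * K x y) (fun y => ∑ x, q x * K x y) ≤ klDiv p q := by
  rw [klDiv_eq_sum hp,
    klDiv_eq_sum fun y => Finset.sum_nonneg fun x _ => mul_nonneg (hp x) (hK x y)]
  calc
    _ ≤ ∑ y, ∑ x, p x * K x y * Real.log (p x * K x y / (q x * K x y)) := by
      refine Finset.sum_le_sum fun y _ => sum_mul_log_div_sum_le _
        (fun x _ => mul_nonneg (hp x) (hK x y)) (fun x _ => mul_nonneg (hq x) (hK x y))
        fun x _ h => ?_
      exact mul_pos (hpq x (pos_of_mul_pos_left h (hK x y))) (pos_of_mul_pos_right h (hp x))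
    _ = ∑ y, ∑ x, p x * Real.log (p x / q x) * K x y := by
      refine Finset.sum_congr rfl fun y _ => Finset.sum_congr rfl fun x _ => ?_
      rcases eq_or_ne (K x y) 0 with h | h
      · simp [h]
      · rw [mul_div_mul_right _ _ h, mul_right_comm]
    _ = ∑ x, p x * Real.log (p x / q x) := by
      rw [Finset.sum_comm]
      simp_rw [← Finset.mul_sum, hK1, mul_one]

/-- Under the Markov factorization
`P(t,g,d|θ) = pT(t|θ) · pG(g|t) · pD(d|g)`, for any two parameter values
θ₀, θ₁ (with `pT(·|θ₀)` absolutely continuous w.r.t. `pT(·|θ₁)`), the KL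
divergence between the marginal distributions `P_D(d|θ) = ∑_{t,g} P(t,g,d|θ)`
of the GAN-generated data is at most the KL divergence between the
distributions of the training data:
`D_KL(P_D(·|θ₀) ‖ P_D(·|θ₁)) ≤ D_KL(pT(·|θ₀) ‖ pT(·|θ₁))`. -/
theorem gan_kl_divergence_le
    {S_T S_G S_D Θ : Type*} [Fintype S_T] [Fintype S_G] [Fintype S_D]
    [Nonempty S_T] [Nonempty S_G] [Nonempty S_D]
    (pT : S_T → Θ → ℝ) (pG : S_G → S_T → ℝ) (pD : S_D → S_G → ℝ)
    (hT0 : ∀ t θ, 0 ≤ pT t θ) (hT1 : ∀ θ, ∑ t, pT t θ = 1)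
    (hG0 : ∀ g t, 0 ≤ pG g t) (hG1 : ∀ t, ∑ g, pG g t = 1)
    (hD0 : ∀ d g, 0 ≤ pD d g) (hD1 : ∀ g, ∑ d, pD d g = 1)
    (P : S_T → S_G → S_D → Θ → ℝ)
    (hP : ∀ t g d θ, P t g d θ = pT t θ * pG g t * pD d g)
    (θ₀ θ₁ : Θ) (hac : ∀ t, 0 < pT t θ₀ → 0 < pT t θ₁) :
    klDiv (fun d : S_D => ∑ t, ∑ g, P t g d θ₀)
          (fun d : S_D => ∑ t, ∑ g, P t g d θ₁)
      ≤ klDiv (fun t => pT t θ₀) (fun t => pT t θ₁) := by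
  have hmarg : ∀ θ, (fun d => ∑ t, ∑ g, P t g d θ)
      = fun d => ∑ t, pT t θ * ∑ g, pG g t * pD d g := fun θ => by
    simp_rw [hP, Finset.mul_sum, mul_assoc]
  rw [hmarg, hmarg]
  refine klDiv_sum_mul_le (hT0 · θ₀) (hT0 · θ₁) hac
    (fun t d => Finset.sum_nonneg fun g _ => mul_nonneg (hG0 g t) (hD0 d g)) fun t => ?_
  rw [Finset.sum_comm]
  simp_rw [← Finset.mul_sum, hD1, mul_one, hG1]
end

section
/- Data processing inequality for Fisher information on finite spaces: let X and Y be finite nonempty types, let U ⊆ ℝ be an open interval, let r(·|θ) be a pmf on X for each θ ∈ U with r(x|θ) > 0 and θ ↦ r(x|θ) differentiable for each x, and let K(·|x) be a θ-independent probability mass function on Y for each x ∈ X. Define the pushforward family s(y|θ) = Σ_x K(y|x)·r(x|θ). Then for every θ ∈ U, the Fisher information of the family s is at most the Fisher information of the family r: Σ_{y : s(y|θ)>0} s(y|θ)·(∂_θ s(y|θ)/s(y|θ))² ≤ Σ_x r(x|θ)·(∂_θ r(x|θ)/r(x|θ))². -/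
/-- Fisher information at `θ` of a family of pmfs `r(·|θ)` on a finite type `X`:
`I^Fisher(θ) = ∑_{x : r(x|θ) > 0} r(x|θ) · (∂_θ r(x|θ) / r(x|θ))²`. -/
noncomputable def fisherInfo {X : Type*} [Fintype X] (r : X → ℝ → ℝ) (θ : ℝ) : ℝ :=
  ∑ x, if 0 < r x θ then r x θ * (deriv (r x) θ / r x θ) ^ 2 else 0

/-- Data processing inequality for Fisher information on finite
spaces: for a family of pmfs `r(·|θ)` on `X` (positive and differentiable in
`θ` on an open interval `U = (a, b)`), and a θ-independent Markov kernel
`K(·|x)` from `X` to `Y`, the pushforward family `s(y|θ) = ∑_x K(y|x)·r(x|θ)`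
has Fisher information at most that of `r` at every `θ ∈ U`. -/
theorem fisher_data_processing_inequality
    {X Y : Type*} [Fintype X] [Fintype Y] [Nonempty X] [Nonempty Y]
    (a b : ℝ) (U : Set ℝ) (hU : U = Set.Ioo a b)
    (r : X → ℝ → ℝ)
    (hr0 : ∀ x, ∀ θ ∈ U, 0 < r x θ) (hr1 : ∀ θ ∈ U, ∑ x, r x θ = 1)
    (hrdiff : ∀ x, ∀ θ ∈ U, DifferentiableAt ℝ (r x) θ)
    (K : Y → X → ℝ)
    (hK0 : ∀ y x, 0 ≤ K y x) (hK1 : ∀ x, ∑ y, K y x = 1)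
    (θ : ℝ) (hθ : θ ∈ U) :
    fisherInfo (fun y θ' => ∑ x, K y x * r x θ') θ ≤ fisherInfo r θ := by
  have hs (y : Y) : deriv (fun θ' => ∑ x, K y x * r x θ') θ = ∑ x, K y x * deriv (r x) θ :=
    (HasDerivAt.fun_sum fun x _ => (hrdiff x θ hθ).hasDerivAt.const_mul (K y x)).deriv
  have hI : fisherInfo r θ = ∑ x, deriv (r x) θ ^ 2 / r x θ := by
    refine Finset.sum_congr rfl fun x _ => ?_
    have := hr0 x θ hθ
    rw [if_pos this]
    field_simp
  calc fisherInfo (fun y θ' => ∑ x, K y x * r x θ') θ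
      ≤ ∑ y, ∑ x, K y x * (deriv (r x) θ ^ 2 / r x θ) := by
        refine Finset.sum_le_sum fun y _ => ?_
        have hnonneg (x : X) : 0 ≤ K y x * (deriv (r x) θ ^ 2 / r x θ) :=
          mul_nonneg (hK0 y x) (div_nonneg (sq_nonneg _) (hr0 x θ hθ).le)
        split_ifs with hpos
        · have hcs := Finset.sum_sq_le_sum_mul_sum_of_sq_le_mul Finset.univ
            (r := fun x => K y x * deriv (r x) θ)
            (fun x _ => mul_nonneg (hK0 y x) (hr0 x θ hθ).le) (fun x _ => hnonneg x)
            (fun x _ => le_of_eq <| by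
              have := (hr0 x θ hθ).ne'
              field_simp)
          rw [hs, div_pow, sq (∑ x, K y x * r x θ), ← mul_div_assoc,
            mul_div_mul_left _ _ hpos.ne', div_le_iff₀' hpos]
          exact hcs
        · exact Finset.sum_nonneg fun x _ => hnonneg x
    _ = fisherInfo r θ := by
        rw [Finset.sum_comm, hI]
        simp_rw [← Finset.sum_mul, hK1, one_mul]
end

section
/- Suppose the parameter θ ranges over an open interval U ⊆ ℝ and for each t ∈ S_T the map θ ↦ pT(t|θ) is differentiable on U with pT(t|θ) > 0. Then the Fisher information contained in the GAN-generated data is at most the Fisher information contained in the training data: for every θ ∈ U, letting P_D(d|θ) = Σ_{t,g} P(t,g,d|θ) denote the marginal distribution of the GAN-generated data, Σ_{d : P_D(d|θ)>0} P_D(d|θ)·(∂_θ P_D(d|θ)/P_D(d|θ))² ≤ Σ_t pT(t|θ)·(∂_θ pT(t|θ)/pT(t|θ))². -/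
/-- Data processing inequality: passing a family of positive weights through a `θ`-independent
stochastic channel does not increase its Fisher information. -/
theorem fisherInfo_channel_le {X Y : Type*} [Fintype X] [Fintype Y] (r : X → ℝ → ℝ)
    (K : Y → X → ℝ) (θ : ℝ) (hr : ∀ x, 0 < r x θ) (hd : ∀ x, DifferentiableAt ℝ (r x) θ)
    (hK0 : ∀ y x, 0 ≤ K y x) (hK1 : ∀ x, ∑ y, K y x = 1) :
    fisherInfo (fun y θ' => ∑ x, r x θ' * K y x) θ ≤ fisherInfo r θ := by
  have hderiv (y : Y) :
      deriv (fun θ' => ∑ x, r x θ' * K y x) θ = ∑ x, deriv (r x) θ * K y x :=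
    (HasDerivAt.fun_sum fun x _ => (hd x).hasDerivAt.mul_const (K y x)).deriv
  have hterm (x : X) : 0 ≤ r x θ * (deriv (r x) θ / r x θ) ^ 2 :=
    mul_nonneg (hr x).le (sq_nonneg _)
  calc fisherInfo (fun y θ' => ∑ x, r x θ' * K y x) θ
      ≤ ∑ y, ∑ x, r x θ * (deriv (r x) θ / r x θ) ^ 2 * K y x := by
        refine Finset.sum_le_sum fun y _ => ?_
        simp only [hderiv]
        split_ifs with hpos
        · have hcs : (∑ x, deriv (r x) θ * K y x) ^ 2 ≤ (∑ x, r x θ * K y x) *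
              ∑ x, r x θ * (deriv (r x) θ / r x θ) ^ 2 * K y x := by
            refine Finset.sum_sq_le_sum_mul_sum_of_sq_le_mul _
              (fun x _ => mul_nonneg (hr x).le (hK0 y x))
              (fun x _ => mul_nonneg (hterm x) (hK0 y x)) fun x _ => ?_
            refine le_of_eq ?_
            have := (hr x).ne'
            field_simp
          rw [div_pow, mul_div_assoc', div_le_iff₀ (by positivity)]
          nlinarith [mul_le_mul_of_nonneg_left hcs hpos.le]
        · exact Finset.sum_nonneg fun x _ => mul_nonneg (hterm x) (hK0 y x)
    _ = fisherInfo r θ := by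
        rw [Finset.sum_comm]
        simp only [← Finset.mul_sum, hK1, mul_one, fisherInfo, hr, if_true]

/-- Under the Markov factorization
`P(t,g,d|θ) = pT(t|θ) · pG(g|t) · pD(d|g)`, with the parameter ranging over an
open interval `U = (a, b) ⊆ ℝ` on which each `θ ↦ pT(t|θ)` is differentiable
and positive, the Fisher information contained in the GAN-generated data (with
marginal distribution `P_D(d|θ) = ∑_{t,g} P(t,g,d|θ)`) is at most the Fisher
information contained in the training data. -/
theorem gan_fisher_information_le
    {S_T S_G S_D : Type*} [Fintype S_T] [Fintype S_G] [Fintype S_D]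
    [Nonempty S_T] [Nonempty S_G] [Nonempty S_D]
    (a b : ℝ) (U : Set ℝ) (hU : U = Set.Ioo a b)
    (pT : S_T → ℝ → ℝ) (pG : S_G → S_T → ℝ) (pD : S_D → S_G → ℝ)
    (hT0 : ∀ t, ∀ θ ∈ U, 0 < pT t θ) (hT1 : ∀ θ ∈ U, ∑ t, pT t θ = 1)
    (hTdiff : ∀ t, ∀ θ ∈ U, DifferentiableAt ℝ (pT t) θ)
    (hG0 : ∀ g t, 0 ≤ pG g t) (hG1 : ∀ t, ∑ g, pG g t = 1)
    (hD0 : ∀ d g, 0 ≤ pD d g) (hD1 : ∀ g, ∑ d, pD d g = 1)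
    (P : S_T → S_G → S_D → ℝ → ℝ)
    (hP : ∀ t g d θ, P t g d θ = pT t θ * pG g t * pD d g)
    (θ : ℝ) (hθ : θ ∈ U) :
    fisherInfo (fun (d : S_D) θ' => ∑ t, ∑ g, P t g d θ') θ
      ≤ fisherInfo pT θ := by
  have hmarg : (fun (d : S_D) θ' => ∑ t, ∑ g, P t g d θ') =
      fun d θ' => ∑ t, pT t θ' * ∑ g, pG g t * pD d g := by
    simp only [hP, Finset.mul_sum, mul_assoc]
  rw [hmarg]
  refine fisherInfo_channel_le pT (fun d t => ∑ g, pG g t * pD d g) θ (fun t => hT0 t θ hθ)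
    (fun t => hTdiff t θ hθ)
    (fun d t => Finset.sum_nonneg fun g _ => mul_nonneg (hG0 g t) (hD0 d g)) fun t => ?_
  rw [Finset.sum_comm]
  simp only [← Finset.mul_sum, hD1, mul_one, hG1]
end
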